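/- arXiv:2210.06077 — 4 statements merged into one kernel-verified Lean document; each statement's English description precedes it below -/
import Mathlib

section
/- Let d ≥ 1, and let x₁, x₂ ∈ EuclideanSpace ℝ (Fin d), k an index, z ∈ ℝ, and r₂ ≥ 0 with (z − x₂ k)² ≤ r₂². Set ρ = √(r₂² − (z − x₂ k)²) and D = √(‖x₂ − x₁‖² − (x₂ k − x₁ k)²). Then every y with ‖y − x₂‖ = r₂ and y k = z satisfies ‖y − x₁‖² ≥ (z − x₁ k)² + (ρ − D)², i.e. ‖y − x₁‖ ≥ √((z − x₁ k)² + (√(r₂² − (z − x₂ k)²) − √(‖x₂ − x₁‖² − (x₂ k − x₁ k)²))²). (Lemma 'Boundary Certifications by way of Eccentric Circles', Eq. (12), lower-bound part.) -/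
theorem EuclideanSpace.real_norm_sq_eq_sq_add_sum_erase {ι : Type*} [Fintype ι] [DecidableEq ι]
    (w : EuclideanSpace ℝ ι) (k : ι) :
    ‖w‖ ^ 2 = w k ^ 2 + ∑ i ∈ Finset.univ.erase k, w i ^ 2 := by
  rw [EuclideanSpace.real_norm_sq_eq, Finset.add_sum_erase _ (fun i => w i ^ 2) (Finset.mem_univ k)]

/-- The reverse triangle inequality for the Euclidean norm, in squared form. -/
theorem sq_sqrt_sub_sqrt_le_sum_add_sq {ι : Type*} (s : Finset ι) (u v : ι → ℝ) :
    (√(∑ i ∈ s, u i ^ 2) - √(∑ i ∈ s, v i ^ 2)) ^ 2 ≤ ∑ i ∈ s, (u i + v i) ^ 2 := by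
  have hcs := Real.sum_mul_le_sqrt_mul_sqrt s (fun i => -u i) v
  simp only [neg_mul, Finset.sum_neg_distrib, neg_sq] at hcs
  have hu := Real.sq_sqrt (Finset.sum_nonneg fun i (_ : i ∈ s) => sq_nonneg (u i))
  have hv := Real.sq_sqrt (Finset.sum_nonneg fun i (_ : i ∈ s) => sq_nonneg (v i))
  simp only [add_sq, Finset.sum_add_distrib, mul_assoc, ← Finset.mul_sum]
  linarith [sub_sq (√(∑ i ∈ s, u i ^ 2)) (√(∑ i ∈ s, v i ^ 2))]

theorem boundary_certification_lower_bound (d : ℕ) (hd : 1 ≤ d)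
    (x₁ x₂ : EuclideanSpace ℝ (Fin d)) (k : Fin d) (z r₂ : ℝ)
    (hr₂ : 0 ≤ r₂) (hz : (z - x₂ k) ^ 2 ≤ r₂ ^ 2) :
    ∀ y : EuclideanSpace ℝ (Fin d), ‖y - x₂‖ = r₂ → y k = z →
      ‖y - x₁‖ ^ 2 ≥ (z - x₁ k) ^ 2 +
        (Real.sqrt (r₂ ^ 2 - (z - x₂ k) ^ 2) -
          Real.sqrt (‖x₂ - x₁‖ ^ 2 - (x₂ k - x₁ k) ^ 2)) ^ 2 := by
  rintro y rfl rfl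
  simp only [EuclideanSpace.real_norm_sq_eq_sq_add_sum_erase _ k, PiLp.sub_apply,
    add_sub_cancel_left]
  rw [ge_iff_le, add_le_add_iff_left]
  simpa only [sub_add_sub_cancel] using sq_sqrt_sub_sqrt_le_sum_add_sq (Finset.univ.erase k)
    (fun i => y i - x₂ i) (fun i => x₂ i - x₁ i)
end

section
/- Let d ≥ 2, and let x₁, x₂ ∈ EuclideanSpace ℝ (Fin d), k an index, z ∈ ℝ, and r₂ ≥ 0 with (z − x₂ k)² ≤ r₂². Set ρ = √(r₂² − (z − x₂ k)²) and D = √(‖x₂ − x₁‖² − (x₂ k − x₁ k)²). Assume the projections of x₁ and x₂ onto the hyperplane {y : y k = z} are distinct, i.e. there exists i ≠ k with x₁ i ≠ x₂ i. Then there exists y with ‖y − x₂‖ = r₂ and y k = z such that ‖y − x₁‖² = (z − x₁ k)² + (ρ − D)². Hence the lower bound of the boundary-certification lemma is attained, and the distance from x₁ to the intersection of the sphere about x₂ with the hyperplane equals √((z − x₁ k)² + (ρ − D)²). -/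
/-- The Pythagorean identity for a coordinate axis and a vector orthogonal to it. -/
theorem EuclideanSpace.norm_sq_smul_single_add_smul {ι : Type*} [Fintype ι] [DecidableEq ι]
    {k : ι} {v : EuclideanSpace ℝ ι} (hv : v k = 0) (a b : ℝ) :
    ‖a • EuclideanSpace.single k (1 : ℝ) + b • v‖ ^ 2 = a ^ 2 + b ^ 2 * ‖v‖ ^ 2 := by
  rw [norm_add_sq_real, inner_smul_left, inner_smul_right, EuclideanSpace.inner_single_left,
    norm_smul, norm_smul, mul_pow, mul_pow]
  simp [hv]

theorem boundary_certification_attained (d : ℕ) (hd : 2 ≤ d)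
    (x₁ x₂ : EuclideanSpace ℝ (Fin d)) (k : Fin d) (z r₂ : ℝ)
    (hr₂ : 0 ≤ r₂) (hz : (z - x₂ k) ^ 2 ≤ r₂ ^ 2)
    (hproj : ∃ i, i ≠ k ∧ x₁ i ≠ x₂ i) :
    ∃ y : EuclideanSpace ℝ (Fin d), ‖y - x₂‖ = r₂ ∧ y k = z ∧
      ‖y - x₁‖ ^ 2 = (z - x₁ k) ^ 2 +
        (Real.sqrt (r₂ ^ 2 - (z - x₂ k) ^ 2) -
          Real.sqrt (‖x₂ - x₁‖ ^ 2 - (x₂ k - x₁ k) ^ 2)) ^ 2 := by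
  set e : EuclideanSpace ℝ (Fin d) := EuclideanSpace.single k 1
  obtain ⟨v, hv⟩ : ∃ v, v = x₂ - x₁ - (x₂ k - x₁ k) • e := ⟨_, rfl⟩
  have hvk : v k = 0 := by simp [hv, e]
  have hsplit : x₂ - x₁ = (x₂ k - x₁ k) • e + (1 : ℝ) • v := by rw [hv]; module
  have hD : Real.sqrt (‖x₂ - x₁‖ ^ 2 - (x₂ k - x₁ k) ^ 2) = ‖v‖ := by
    rw [hsplit, EuclideanSpace.norm_sq_smul_single_add_smul hvk, one_pow, one_mul,
      add_sub_cancel_left, Real.sqrt_sq (norm_nonneg v)]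
  have hv0 : ‖v‖ ≠ 0 := by
    obtain ⟨i, hik, hi⟩ := hproj
    rw [norm_ne_zero_iff]
    intro h
    have hvi : v i = x₂ i - x₁ i := by simp [hv, e, hik]
    rw [h] at hvi
    exact hi (sub_eq_zero.mp hvi.symm).symm
  rw [hD]
  have hρ := Real.sq_sqrt (sub_nonneg.mpr hz)
  set ρ := Real.sqrt (r₂ ^ 2 - (z - x₂ k) ^ 2)
  refine ⟨x₂ + ((z - x₂ k) • e + (-(ρ / ‖v‖)) • v), ?_, by simp [e, hvk], ?_⟩
  · rw [add_sub_cancel_left, ← sq_eq_sq₀ (norm_nonneg _) hr₂,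
      EuclideanSpace.norm_sq_smul_single_add_smul hvk, neg_sq, div_pow,
      div_mul_cancel₀ _ (pow_ne_zero 2 hv0), hρ]
    ring
  · have hy : x₂ + ((z - x₂ k) • e + (-(ρ / ‖v‖)) • v) - x₁ =
        (z - x₁ k) • e + (1 - ρ / ‖v‖) • v := by
      rw [hv]; module
    rw [hy, EuclideanSpace.norm_sq_smul_single_add_smul hvk]
    field_simp
    ring
end

section
/- Let d ≥ 1 and σ > 0, and let g : (Fin d → ℝ) → ℝ be a measurable function that is bounded (there exists C with |g(y)| ≤ C for all y). For x : Fin d → ℝ, let μ_x be the product measure on Fin d → ℝ whose i-th factor is the Gaussian measure on ℝ with mean x i and variance σ², and define F(x) = ∫ g dμ_x. Then for every x and every coordinate j, the one-variable function t ↦ F(x with its j-th coordinate replaced by t) is differentiable at t = x j, with derivative (1/σ²) ∫ g(y) · (y j − x j) dμ_x(y). (Multidimensional gradient identity, Eq. (14).) -/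
open MeasureTheory ProbabilityTheory

/-- Reweighting one factor of a product measure by a density reweights the product by the same
density, read along that coordinate. -/
theorem MeasureTheory.Measure.pi_eq_withDensity_eval {ι : Type*} [Fintype ι] {X : ι → Type*}
    {mX : ∀ i, MeasurableSpace (X i)} (μ ν : ∀ i, Measure (X i))
    [∀ i, IsProbabilityMeasure (μ i)] [∀ i, SigmaFinite (ν i)] (j : ι) {f : X j → ENNReal}
    (hf : Measurable f) (hj : ν j = (μ j).withDensity f) (hne : ∀ i ≠ j, ν i = μ i) :
    Measure.pi ν = (Measure.pi μ).withDensity fun y => f (y j) := by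
  classical
  refine Measure.pi_eq fun s hs => ?_
  let h : ∀ i, X i → ENNReal := fun i =>
    (s i).indicator (Function.update (fun _ _ => 1) j f i)
  have hupdate : ∀ i, Measurable
      (Function.update (fun (i : ι) (_ : X i) => (1 : ENNReal)) j f i) := by
    intro i
    obtain rfl | hij := eq_or_ne i j
    · simpa using hf
    · simp [hij]
  have hh : ∀ i, Measurable (h i) := fun i => (hupdate i).indicator (hs i)
  have hprod : ∀ y : ∀ i, X i,
      (Set.univ.pi s).indicator (fun y => f (y j)) y = ∏ i, h i (y i) := by
    intro y
    by_cases hy : y ∈ Set.univ.pi s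
    · have hmem : ∀ i, y i ∈ s i := fun i => hy i (Set.mem_univ i)
      simp only [Set.indicator_of_mem hy, h, Set.indicator_of_mem (hmem _)]
      rw [Finset.prod_eq_single j]
      · simp
      · intro i _ hij
        simp [hij]
      · simp
    · rw [Set.indicator_of_notMem hy]
      simp only [Set.mem_univ_pi, not_forall] at hy
      obtain ⟨i, hi⟩ := hy
      exact (Finset.prod_eq_zero (Finset.mem_univ i) (Set.indicator_of_notMem hi _)).symm
  rw [withDensity_apply _ (MeasurableSet.univ_pi hs),
    ← lintegral_indicator (MeasurableSet.univ_pi hs)]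
  simp_rw [hprod]
  have hindep : iIndepFun (fun i (y : ∀ i, X i) => h i (y i)) (Measure.pi μ) :=
    iIndepFun_pi fun i => (hh i).aemeasurable
  rw [lintegral_prod_eq_prod_lintegral_of_indepFun Finset.univ _ hindep
    fun i => (hh i).comp (measurable_pi_apply i)]
  refine Finset.prod_congr rfl fun i _ => ?_
  rw [(measurePreserving_eval μ i).lintegral_comp (hh i), lintegral_indicator (hs i)]
  obtain rfl | hij := eq_or_ne i j
  · simp [hj, withDensity_apply _ (hs i)]
  · simp [hij, hne i hij]

/-- The Cameron-Martin density of a shifted real Gaussian measure. -/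
theorem ProbabilityTheory.gaussianReal_eq_withDensity_gaussianReal (m t : ℝ) {v : NNReal}
    (hv : v ≠ 0) :
    gaussianReal t v = (gaussianReal m v).withDensity fun y =>
      ENNReal.ofReal (Real.exp (((t - m) * (y - m) - (t - m) ^ 2 / 2) / v)) := by
  rw [gaussianReal_of_var_ne_zero _ hv, gaussianReal_of_var_ne_zero _ hv,
    ← withDensity_mul _ (by fun_prop) (by fun_prop)]
  congr 1
  ext1 y
  have hv' : (v : ℝ) ≠ 0 := by exact_mod_cast hv
  simp only [gaussianPDF, Pi.mul_apply]
  rw [← ENNReal.ofReal_mul (gaussianPDFReal_nonneg _ _ _)]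
  simp only [gaussianPDFReal, mul_assoc, ← Real.exp_add]
  congr 4
  field_simp
  ring

theorem gaussian_smoothing_partial_deriv (d : ℕ) (hd : 1 ≤ d) (σ : ℝ) (hσ : 0 < σ)
    (g : (Fin d → ℝ) → ℝ) (hg : Measurable g) (C : ℝ) (hC : ∀ y, |g y| ≤ C)
    (x : Fin d → ℝ) (j : Fin d) :
    HasDerivAt
      (fun t : ℝ => ∫ y : Fin d → ℝ, g y
        ∂(Measure.pi fun i => gaussianReal (Function.update x j t i) ⟨σ ^ 2, sq_nonneg σ⟩))
      ((1 / σ ^ 2) * ∫ y : Fin d → ℝ, g y * (y j - x j)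
        ∂(Measure.pi fun i => gaussianReal (x i) ⟨σ ^ 2, sq_nonneg σ⟩)) (x j) := by
  have hs : 0 < σ ^ 2 := by positivity
  obtain ⟨v, hv⟩ : ∃ v : NNReal, v = ⟨σ ^ 2, sq_nonneg σ⟩ := ⟨_, rfl⟩
  have hvσ : (v : ℝ) = σ ^ 2 := by rw [hv]; rfl
  rw [← hv, ← hvσ]
  have hv_pos : (0 : ℝ) < v := hvσ ▸ hs
  have hv0 : v ≠ 0 := by exact_mod_cast hv_pos.ne'
  set μ : Measure (Fin d → ℝ) := Measure.pi fun i => gaussianReal (x i) v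
  let E : ℝ → (Fin d → ℝ) → ℝ := fun t y =>
    Real.exp (((t - x j) * (y j - x j) - (t - x j) ^ 2 / 2) / v)
  have hE : ∀ t, Measurable (E t) := fun t => by fun_prop
  have hF : (fun t : ℝ => ∫ y : Fin d → ℝ, g y
        ∂(Measure.pi fun i => gaussianReal (Function.update x j t i) v)) =
      fun t => ∫ y, E t y * g y ∂μ := by
    ext t
    rw [Measure.pi_eq_withDensity_eval (fun i => gaussianReal (x i) v) _ j
      (f := fun z => ENNReal.ofReal
        (Real.exp (((t - x j) * (z - x j) - (t - x j) ^ 2 / 2) / v))) (by fun_prop)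
      (by simpa using gaussianReal_eq_withDensity_gaussianReal (x j) t hv0)
      (fun i hi => by simp [hi])]
    rw [integral_withDensity_eq_integral_toReal_smul (by fun_prop) (by simp)]
    simp [E, ENNReal.toReal_ofReal (Real.exp_nonneg _), μ]
  have hC0 : 0 ≤ C := (abs_nonneg _).trans (hC 0)
  have hbound_int : Integrable (fun y : Fin d → ℝ =>
      C / v * Real.exp ((1 / v + 1) * |y j - x j|)) μ := by
    refine Integrable.const_mul ?_ _
    have key : ∀ c : ℝ, Integrable (fun y : Fin d → ℝ => Real.exp (c * (y j - x j))) μ := by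
      intro c
      have heval := measurePreserving_eval (fun i => gaussianReal (x i) v) j
      have h := heval.integrable_comp_of_integrable
        ((integrable_exp_mul_gaussianReal (μ := x j) (v := v) c).const_mul
          (Real.exp (-c * x j)))
      refine h.congr (ae_of_all _ fun y => ?_)
      simp only [Function.comp, Function.eval, ← Real.exp_add]
      congr 1
      ring
    exact integrable_exp_mul_abs (key _) (key _)
  have h := (hasDerivAt_integral_of_dominated_loc_of_deriv_le (μ := μ) (x₀ := x j)
    (F := fun t y => E t y * g y)
    (F' := fun t y => E t y * (((y j - x j) - (t - x j)) / v) * g y)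
    (Metric.ball_mem_nhds (x j) one_pos)
    (Filter.Eventually.of_forall fun t => ((hE t).mul hg).aestronglyMeasurable)
    ?_ ?_ (ae_of_all _ ?_) hbound_int (ae_of_all _ ?_)).2
  · rw [hF]
    refine h.congr_deriv ?_
    rw [← integral_const_mul]
    refine integral_congr_ae (ae_of_all _ fun y => ?_)
    simp [E]
    ring
  · refine (Integrable.of_bound hg.aestronglyMeasurable C (ae_of_all _ hC)).congr
      (ae_of_all _ fun y => ?_)
    simp [E]
  · exact (((hE _).mul (by fun_prop)).mul hg).aestronglyMeasurable
  · intro y t ht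
    have ht' : |t - x j| ≤ 1 := by
      rw [Metric.mem_ball, Real.dist_eq] at ht
      exact ht.le
    have hexp : E t y ≤ Real.exp (1 / v * |y j - x j|) := by
      rw [Real.exp_le_exp, one_div_mul_eq_div]
      gcongr
      have h1 : (t - x j) * (y j - x j) ≤ |y j - x j| := by
        refine (le_abs_self _).trans ?_
        rw [abs_mul]
        exact mul_le_of_le_one_left (abs_nonneg _) ht'
      linarith [sq_nonneg (t - x j)]
    have hlin : |(y j - x j) - (t - x j)| ≤ Real.exp |y j - x j| := by
      linarith [abs_sub (y j - x j) (t - x j), Real.add_one_le_exp |y j - x j|]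
    rw [norm_mul, norm_mul, Real.norm_eq_abs, Real.norm_eq_abs, Real.norm_eq_abs, abs_div,
      abs_of_pos hv_pos, abs_of_pos (Real.exp_pos _)]
    calc E t y * (|(y j - x j) - (t - x j)| / v) * |g y|
        ≤ Real.exp (1 / v * |y j - x j|) * (Real.exp |y j - x j| / v) * C := by
          gcongr
          exact hC y
      _ = C / v * Real.exp ((1 / v + 1) * |y j - x j|) := by
          rw [add_mul, one_mul, Real.exp_add]
          ring
  · intro y t _
    have h1 : HasDerivAt (fun t : ℝ => t - x j) 1 t := (hasDerivAt_id t).sub_const _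
    have h2 := (((h1.mul_const (y j - x j)).sub ((h1.pow 2).div_const 2)).div_const (v : ℝ)).exp
    refine (h2.mul_const (g y)).congr_deriv ?_
    simp [E]
end

section
/- Let E be a real inner product space, u ∈ E with ‖u‖ = 1, x₁ ∈ E, d₂, d₃ > 0, x₂ = x₁ − d₂ • u, x₃ = x₁ + d₃ • u, and r₂, r₃ ∈ ℝ. If there exists a point y ∈ E with ‖y − x₂‖ = r₂ and ‖y − x₃‖ = r₃ (i.e. the two spheres intersect), then d₂·(r₃² − d₃²) + d₃·(r₂² − d₂²) ≥ 0, so the certified radius expression r″ = √((d₂(r₃² − d₃²) + d₃(r₂² − d₂²))/(d₂ + d₃)) of Eq. (11) is a well-defined real number. -/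
/-- Stewart's theorem for the cevian through `x`, where `x - a • u` and `x + b • u` are the
endpoints of the side and `u` is a unit vector. -/
theorem mul_norm_sq_add_mul_norm_sq_of_norm_eq_one {E : Type*} [NormedAddCommGroup E]
    [InnerProductSpace ℝ E] {u : E} (hu : ‖u‖ = 1) (x y : E) (a b : ℝ) :
    a * (‖y - (x + b • u)‖ ^ 2 - b ^ 2) + b * (‖y - (x - a • u)‖ ^ 2 - a ^ 2) =
      (a + b) * ‖y - x‖ ^ 2 := by
  rw [← sub_sub, ← sub_add, norm_sub_sq_real, norm_add_sq_real]
  simp only [norm_smul, inner_smul_right, hu, mul_one, Real.norm_eq_abs, sq_abs]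
  ring

theorem eccentric_spheres_radius_nonneg {E : Type*} [NormedAddCommGroup E]
    [InnerProductSpace ℝ E] (u : E) (hu : ‖u‖ = 1) (x₁ : E) (d₂ d₃ : ℝ)
    (hd₂ : 0 < d₂) (hd₃ : 0 < d₃)
    (x₂ x₃ : E) (hx₂ : x₂ = x₁ - d₂ • u) (hx₃ : x₃ = x₁ + d₃ • u)
    (r₂ r₃ : ℝ) (hinter : ∃ y : E, ‖y - x₂‖ = r₂ ∧ ‖y - x₃‖ = r₃) :
    d₂ * (r₃ ^ 2 - d₃ ^ 2) + d₃ * (r₂ ^ 2 - d₂ ^ 2) ≥ 0 := by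
  obtain ⟨y, rfl, rfl⟩ := hinter
  rw [hx₂, hx₃, mul_norm_sq_add_mul_norm_sq_of_norm_eq_one hu]
  positivity
end
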